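/- arXiv:2310.17592 — 4 statements merged into one kernel-verified Lean document; each statement's English description precedes it below -/
import Mathlib

section
/- Let G be an abelian group, let H and H' be proper subgroups of G, and let b ∈ G be such that G = H ∪ (H' + b), where H' + b denotes the coset {h + b : h ∈ H'}. Then H = H', and consequently H has index 2 in G. -/
/-- **Lemma 2.7 (Lemma `Lemma 2` in the paper).**
Let `G` be an abelian group, `H` and `H'` proper subgroups of `G`, and `b ∈ G` such that
`G = H ∪ (H' + b)`. Then `H = H'`, and consequently `H` has index `2` in `G`. -/
theorem subgroup_union_coset_cover {G : Type*} [AddCommGroup G]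
    (H H' : AddSubgroup G) (hH : H ≠ ⊤) (hH' : H' ≠ ⊤) (b : G)
    (hcover : (H : Set G) ∪ ((fun h => h + b) '' (H' : Set G)) = Set.univ) :
    H = H' ∧ H.index = 2 := by
  have cover (x : G) : x ∈ H ∨ x - b ∈ H' := by
    have hx : x ∈ (H : Set G) ∪ ((fun h => h + b) '' (H' : Set G)) := hcover ▸ Set.mem_univ x
    rcases hx with hx | ⟨h, hh, rfl⟩
    · exact Or.inl hx
    · exact Or.inr (by simpa using hh)
  obtain ⟨u, hu⟩ : ∃ u, u ∉ H := by
    by_contra! h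
    exact hH ((AddSubgroup.eq_top_iff' H).2 h)
  obtain ⟨v, hv⟩ : ∃ v, v ∉ H' := by
    by_contra! h
    exact hH' ((AddSubgroup.eq_top_iff' H').2 h)
  have hbH' : b ∉ H' := by
    intro hb
    have union (x : G) : x ∈ H ∨ x ∈ H' :=
      (cover x).imp_right fun h => by simpa using add_mem h hb
    have huH' := (union u).resolve_left hu
    have hvH := (union v).resolve_right hv
    rcases union (u + v) with h | h
    · exact hu ((add_mem_cancel_right hvH).1 h)
    · exact hv ((add_mem_cancel_left huH').1 h)
  have hle : H' ≤ H := fun x hx =>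
    (cover x).resolve_right fun h => hbH' (by simpa using sub_mem hx h)
  have hbH : b ∉ H := fun hb =>
    hu (by simpa using add_mem (hle ((cover u).resolve_left hu)) hb)
  have heq : H = H' := by
    refine le_antisymm (fun x hx => ?_) hle
    simpa using (cover (x + b)).resolve_left fun h => hbH ((add_mem_cancel_left hx).1 h)
  refine ⟨heq, AddSubgroup.index_eq_two_iff.2 ⟨-b, fun x => ?_⟩⟩
  rw [← sub_eq_add_neg]
  by_cases hx : x ∈ H
  · exact Or.inr ⟨hx, fun h => hbH (by simpa using sub_mem hx h)⟩
  · exact Or.inl ⟨hle ((cover x).resolve_left hx), hx⟩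
end

section
/- Let Λ ⊆ ℂ be a lattice and let α₁, α₂, α₃ be nonzero complex numbers each satisfying αᵢΛ ⊆ Λ. Suppose that for every choice of indices with {i, j, k} = {1, 2, 3} we have (1/αᵢ)Λ ⊆ (1/αⱼ)Λ ∪ (1/αₖ)Λ. Then there exist indices i ≠ j and a complex number u with uΛ = Λ such that αⱼ = u·αᵢ. -/
/-- `Λ` is a lattice in `ℂ`: an additive subgroup of the form `ℤω₁ + ℤω₂` with `ω₁, ω₂`
linearly independent over `ℝ`. -/
def IsComplexLattice (Λ : AddSubgroup ℂ) : Prop :=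
  ∃ ω₁ ω₂ : ℂ, LinearIndependent ℝ ![ω₁, ω₂] ∧ Λ = AddSubgroup.closure {ω₁, ω₂}

/-- If each of three elements of a preorder lies below another of them, then two of them lie below
each other. -/
theorem exists_ne_and_le_and_le_of_forall_le_or_le {P : Type*} [Preorder P] {f : Fin 3 → P}
    (h : ∀ i j k : Fin 3, i ≠ j → j ≠ k → i ≠ k → f i ≤ f j ∨ f i ≤ f k) :
    ∃ i j : Fin 3, i ≠ j ∧ f i ≤ f j ∧ f j ≤ f i := by
  rcases h 0 1 2 (by decide) (by decide) (by decide) with h₀ | h₀ <;>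
  rcases h 1 2 0 (by decide) (by decide) (by decide) with h₁ | h₁ <;>
  rcases h 2 0 1 (by decide) (by decide) (by decide) with h₂ | h₂
  · exact ⟨0, 1, by decide, h₀, h₁.trans h₂⟩
  · exact ⟨1, 2, by decide, h₁, h₂⟩
  · exact ⟨0, 1, by decide, h₀, h₁⟩
  · exact ⟨0, 1, by decide, h₀, h₁⟩
  · exact ⟨0, 2, by decide, h₀, h₂⟩
  · exact ⟨1, 2, by decide, h₁, h₂⟩
  · exact ⟨0, 2, by decide, h₀, h₂⟩
  · exact ⟨0, 2, by decide, h₀, h₂.trans h₁⟩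

/-- If `a⁻¹ Λ = b⁻¹ Λ` for nonzero `a` and `b`, then `(b / a) Λ = Λ`. -/
theorem AddSubgroup.map_mulLeft_div_eq_self {K : Type*} [Field K] {Λ : AddSubgroup K} {a b : K}
    (ha : a ≠ 0) (hb : b ≠ 0)
    (h : Λ.comap (AddMonoidHom.mulLeft a) = Λ.comap (AddMonoidHom.mulLeft b)) :
    Λ.map (AddMonoidHom.mulLeft (b / a)) = Λ := by
  have hmem (z : K) : a * z ∈ Λ ↔ b * z ∈ Λ := SetLike.ext_iff.mp h z
  ext w
  simp only [AddSubgroup.mem_map, AddMonoidHom.coe_mulLeft]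
  constructor
  · rintro ⟨z, hz, rfl⟩
    rw [div_mul_eq_mul_div, mul_div_assoc, ← hmem, mul_div_cancel₀ _ ha]
    exact hz
  · intro hw
    refine ⟨a * (w / b), ?_, by field_simp⟩
    rwa [hmem, mul_div_cancel₀ _ hb]

/-- If `α₁, α₂, α₃` are nonzero multipliers of a lattice `Λ ⊆ ℂ` such that
`(1/αᵢ)Λ ⊆ (1/αⱼ)Λ ∪ (1/αₖ)Λ` for every permutation `(i,j,k)` of `(1,2,3)`, then
`αⱼ = u·αᵢ` for some `i ≠ j` and some unit `u` of `Λ`. -/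
theorem unit_relation_of_lattice_inclusions (Λ : AddSubgroup ℂ)
    (hΛ : IsComplexLattice Λ) (α : Fin 3 → ℂ) (hα : ∀ i, α i ≠ 0)
    (hmult : ∀ i, ∀ z ∈ Λ, α i * z ∈ Λ)
    (hsub : ∀ i j k : Fin 3, i ≠ j → j ≠ k → i ≠ k →
      {z : ℂ | α i * z ∈ Λ} ⊆ {z : ℂ | α j * z ∈ Λ} ∪ {z : ℂ | α k * z ∈ Λ}) :
    ∃ i j : Fin 3, i ≠ j ∧
      ∃ u : ℂ, Λ.map (AddMonoidHom.mulLeft u) = Λ ∧ α j = u * α i := by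
  obtain ⟨i, j, hij, hle, hge⟩ := exists_ne_and_le_and_le_of_forall_le_or_le
    (f := fun i ↦ Λ.comap (AddMonoidHom.mulLeft (α i)))
    fun i j k hij hjk hik ↦ AddSubgroupClass.subset_union.mp (hsub i j k hij hjk hik)
  exact ⟨i, j, hij, α j / α i,
    AddSubgroup.map_mulLeft_div_eq_self (hα i) (hα j) (le_antisymm hle hge),
    (div_mul_cancel₀ _ (hα i)).symm⟩
end

section
/- Let c₁, c₂, c₃ be nonzero complex numbers, let u ∈ ℂ be a root of unity, and let w be a nonzero complex number. If the equation c₁ + c₂·u^{2n} + c₃·w^{2n} = 0 holds for infinitely many positive integers n, then w is a root of unity. -/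
/-- In a group with zero, a nonzero element with two equal powers is a root of unity. -/
theorem exists_pow_eq_one_of_pow_eq_pow {G₀ : Type*} [GroupWithZero G₀] {w : G₀} (hw : w ≠ 0)
    {a b : ℕ} (hab : a ≠ b) (h : w ^ a = w ^ b) : ∃ k : ℕ, 0 < k ∧ w ^ k = 1 := by
  wlog hlt : a < b generalizing a b
  · exact this hab.symm h.symm (by omega)
  refine ⟨b - a, by omega, mul_left_cancel₀ (pow_ne_zero a hw) ?_⟩
  rw [← pow_add, Nat.add_sub_cancel' hlt.le, mul_one, h]


/-- If `c₁ + c₂·u^(2n) + c₃·w^(2n) = 0` for infinitely many positive integers `n`, where the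
`cᵢ` are nonzero, `u` is a root of unity, and `w ≠ 0`, then `w` is a root of unity. -/
theorem root_of_unity_of_infinitely_many_relations
    (c₁ c₂ c₃ u w : ℂ) (hc₁ : c₁ ≠ 0) (hc₂ : c₂ ≠ 0) (hc₃ : c₃ ≠ 0)
    (hu : ∃ k : ℕ, 0 < k ∧ u ^ k = 1) (hw : w ≠ 0)
    (hinf : {n : ℕ | 0 < n ∧ c₁ + c₂ * u ^ (2 * n) + c₃ * w ^ (2 * n) = 0}.Infinite) :
    ∃ k : ℕ, 0 < k ∧ w ^ k = 1 := by
  obtain ⟨k, hk, huk⟩ := hu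
  obtain ⟨m, hm, n, hn, hne, hmod⟩ := hinf.exists_ne_map_eq_of_mapsTo
    (f := fun n => n % k) (t := Set.Iio k) (fun n _ => Nat.mod_lt n hk) (Set.finite_Iio k)
  have hun : u ^ m = u ^ n := by
    rw [pow_eq_pow_mod m huk, pow_eq_pow_mod n huk]
    exact congrArg (u ^ ·) hmod
  have hu2 : u ^ (2 * m) = u ^ (2 * n) := by rw [mul_comm 2 m, mul_comm 2 n, pow_mul, pow_mul, hun]
  refine exists_pow_eq_one_of_pow_eq_pow hw (a := 2 * m) (b := 2 * n) (by omega)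
    (mul_left_cancel₀ hc₃ ?_)
  linear_combination hm.2 - hn.2 - c₂ * hu2
end

section
/- Let a be a nonzero complex number and let (X, Y) ∈ ℂ² satisfy Y² = X³ + aX² − 3a²X + a³ with X ≠ a. Define X' = −(1/2)·(X + a + 2a²/(X − a)) and Y' = −(1/(2·i√2))·Y·(1 − 2a²/(X − a)²). Then Y'² = X'³ + aX'² − 3a²X' + a³, i.e. (X', Y') is again an affine point of the curve E_a. -/
open Complex

/-- If `(X, Y)` is an affine point of the curve `E_a : y² = x³ + a·x² − 3a²·x + a³` with `X ≠ a`,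
then its image `(X', Y')` under the complex-multiplication endomorphism `[√−2]` is again an
affine point of `E_a`. -/
theorem sqrt_neg_two_endomorphism_maps_to_curve (a X Y : ℂ) (ha : a ≠ 0)
    (hXY : Y ^ 2 = X ^ 3 + a * X ^ 2 - 3 * a ^ 2 * X + a ^ 3) (hXa : X ≠ a)
    (X' Y' : ℂ)
    (hX' : X' = -(1 / 2) * (X + a + 2 * a ^ 2 / (X - a)))
    (hY' : Y' = -(1 / (2 * (Complex.I * Real.sqrt 2))) * Y * (1 - 2 * a ^ 2 / (X - a) ^ 2)) :
    Y' ^ 2 = X' ^ 3 + a * X' ^ 2 - 3 * a ^ 2 * X' + a ^ 3 := by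
  have hu : X - a ≠ 0 := sub_ne_zero.mpr hXa
  have hsqrt : ((Real.sqrt 2 : ℝ) : ℂ) ^ 2 = 2 := by
    rw [← Complex.ofReal_pow, Real.sq_sqrt zero_le_two, Complex.ofReal_ofNat]
  have hcoeff : (-(1 / (2 * (Complex.I * (Real.sqrt 2 : ℂ))))) ^ 2 = -(1 / 8) := by
    rw [neg_sq, div_pow, mul_pow, mul_pow, Complex.I_sq, hsqrt]
    norm_num
  rw [hY', mul_pow, mul_pow, hcoeff, hXY, hX']
  field_simp
  ring
end
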